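/- arXiv:2006.06551 — 2 statements merged into one kernel-verified Lean document; each statement's English description precedes it below -/
import Mathlib

section
/- For every finite connected simple graph G, the rainbow connection number of G is at most f(G) + 2, where f(G) is the forest number of G. That is, there exists an edge-coloring of G using at most f(G) + 2 colors under which every pair of vertices of G is joined by a rainbow path. -/
open SimpleGraph

/-- A coloring `c` of the (potential) edges of `G` makes `G` rainbow-connected if every pair of
vertices is joined by a path whose edges all receive pairwise distinct colors. -/
def IsRainbowConnected {V : Type*} {n : ℕ} (G : SimpleGraph V) (c : Sym2 V → Fin n) : Prop :=
  ∀ u v : V, ∃ p : G.Walk u v, p.IsPath ∧ (p.edges.map c).Nodup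

/- The forest number of `G`: the maximum number of vertices inducing an acyclic subgraph. -/
open Classical in
noncomputable def forestNum {V : Type*} [Fintype V] (G : SimpleGraph V) : ℕ :=
  Nat.findGreatest
    (fun n => ∃ S : Finset V, S.card = n ∧ (G.induce (S : Set V)).IsAcyclic)
    (Fintype.card V)

/-- `y` can be reached from `x` by a rainbow walk of `G` inside `D`, with colors in `K`. -/
def RainbowReach {V C : Type*} (G : SimpleGraph V) (c : Sym2 V → C) (D : Set V) (K : Set C)
    (x y : V) : Prop :=
  ∃ p : G.Walk x y, (∀ z ∈ p.support, z ∈ D) ∧ (∀ e ∈ p.edges, c e ∈ K) ∧ (p.edges.map c).Nodup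

namespace RainbowReach

variable {V C : Type*} {G : SimpleGraph V} {c c' : Sym2 V → C} {D D' : Set V} {K K' : Set C}
  {x y z : V}

theorem refl (hx : x ∈ D) : RainbowReach G c D K x x :=
  ⟨.nil, by simpa using hx, by simp, by simp⟩

theorem of_adj (h : G.Adj x y) (hx : x ∈ D) (hy : y ∈ D) (hc : c s(x, y) ∈ K) :
    RainbowReach G c D K x y :=
  ⟨.cons h .nil, by simp [hx, hy], by simpa using hc, by simp⟩

theorem symm (h : RainbowReach G c D K x y) : RainbowReach G c D K y x := by
  obtain ⟨p, h1, h2, h3⟩ := h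
  exact ⟨p.reverse, by simpa using h1, by simpa using h2, by simpa using h3⟩

theorem mono (h : RainbowReach G c D K x y) (hD : D ⊆ D') (hK : K ⊆ K') :
    RainbowReach G c D' K' x y := by
  obtain ⟨p, h1, h2, h3⟩ := h
  exact ⟨p, fun z hz => hD (h1 z hz), fun e he => hK (h2 e he), h3⟩

theorem trans (h : RainbowReach G c D K x y) (h' : RainbowReach G c D K' y z)
    (hK : Disjoint K K') : RainbowReach G c D (K ∪ K') x z := by
  obtain ⟨p, h1, h2, h3⟩ := h
  obtain ⟨q, h1', h2', h3'⟩ := h'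
  refine ⟨p.append q, ?_, ?_, ?_⟩
  · intro z hz
    rw [Walk.mem_support_append_iff] at hz
    exact hz.elim (h1 z) (h1' z)
  · intro e he
    rw [Walk.edges_append, List.mem_append] at he
    exact he.imp (h2 e) (h2' e)
  · rw [Walk.edges_append, List.map_append, List.nodup_append']
    refine ⟨h3, h3', ?_⟩
    intro k hk hk'
    obtain ⟨e, he, rfl⟩ := List.mem_map.1 hk
    obtain ⟨e', he', hee⟩ := List.mem_map.1 hk'
    exact Set.disjoint_left.1 hK (h2 e he) (hee ▸ h2' e' he')

theorem congr (h : RainbowReach G c D K x y) (hc : ∀ e : Sym2 V, (∀ z ∈ e, z ∈ D) → c' e = c e) :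
    RainbowReach G c' D K x y := by
  obtain ⟨p, h1, h2, h3⟩ := h
  have hcc : ∀ e ∈ p.edges, c' e = c e := fun e he =>
    hc e fun z hz => h1 z (p.mem_support_of_mem_edges he hz)
  refine ⟨p, h1, fun e he => hcc e he ▸ h2 e he, ?_⟩
  rwa [List.map_congr_left hcc]

theorem exists_isPath (h : RainbowReach G c D K x y) :
    ∃ p : G.Walk x y, p.IsPath ∧ (p.edges.map c).Nodup := by
  classical
  obtain ⟨p, -, -, h3⟩ := h
  refine ⟨p.bypass, p.bypass_isPath, List.Nodup.map_on ?_ p.bypass_isPath.isTrail.edges_nodup⟩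
  intro e he e' he'
  exact List.inj_on_of_nodup_map h3 (p.edges_bypass_subset_edges he)
    (p.edges_bypass_subset_edges he')

end RainbowReach

/-- Adding a vertex with at most one neighbor in `S` keeps the induced subgraph acyclic. -/
theorem SimpleGraph.IsAcyclic.induce_insert {V : Type*} {G : SimpleGraph V} {S : Set V} {t : V}
    (hS : (G.induce S).IsAcyclic)
    (ht : ∀ s ∈ S, ∀ s' ∈ S, G.Adj t s → G.Adj t s' → s = s') :
    (G.induce (insert t S)).IsAcyclic := by
  classical
  intro v p hp
  let t' : (insert t S : Set V) := ⟨t, Set.mem_insert _ _⟩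
  by_cases htp : t' ∈ p.support
  · have hq : (p.rotate t' htp).IsCycle := by simpa using hp
    set q := p.rotate t' htp
    have h1 := q.adj_snd hq.not_nil
    have h2 := (q.adj_penultimate hq.not_nil).symm
    have mem : ∀ z : (insert t S : Set V), (G.induce (insert t S)).Adj t' z → (z : V) ∈ S :=
      fun z hz => z.2.resolve_left fun h => hz.ne (Subtype.ext h.symm)
    exact hq.snd_ne_penultimate (Subtype.ext (ht _ (mem _ h1) _ (mem _ h2) h1 h2))
  · have hS' : ∀ z ∈ (p.map (Embedding.induce (insert t S)).toHom).support, z ∈ S := by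
      intro z hz
      rw [Walk.support_map, List.mem_map] at hz
      obtain ⟨a, ha, rfl⟩ := hz
      refine a.2.resolve_left fun h => htp ?_
      rwa [show t' = a from Subtype.ext h.symm]
    have hc : (p.map (Embedding.induce (insert t S)).toHom).IsCycle :=
      hp.map (Embedding.induce (G := G) (insert t S)).injective
    refine hS ((p.map (Embedding.induce (insert t S)).toHom).induce S hS') ?_
    rw [← Walk.isCycle_map_iff_of_injective (f := (Embedding.induce (G := G) S).toHom)
      (Embedding.induce (G := G) S).injective, Walk.map_induce]
    exact hc

/-- Vertex sets grown from `{w}` by repeatedly adding a vertex that has exactly one neighbor in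
the current set: the vertex sets of induced trees containing `w`. -/
inductive GrownTree {V : Type*} [DecidableEq V] (G : SimpleGraph V) (w : V) : Finset V → Prop
  | singleton : GrownTree G w {w}
  | grow {T : Finset V} {t s : V} : GrownTree G w T → t ∉ T → s ∈ T → G.Adj t s →
      (∀ s' ∈ T, G.Adj t s' → s' = s) → GrownTree G w (insert t T)

namespace GrownTree

variable {V : Type*} [DecidableEq V] {G : SimpleGraph V} {w : V} {T : Finset V}

theorem root_mem (h : GrownTree G w T) : w ∈ T := by
  induction h with
  | singleton => simp
  | grow _ _ _ _ _ ih => exact Finset.mem_insert_of_mem ih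

theorem isAcyclic_union (h : GrownTree G w T) {F : Set V} (hF : (G.induce F).IsAcyclic)
    (hFT : ∀ x ∈ F, ∀ y ∈ T, ¬ G.Adj x y) : (G.induce (F ∪ T)).IsAcyclic := by
  induction h with
  | singleton =>
    rw [Finset.coe_singleton, Set.union_singleton]
    exact hF.induce_insert fun s hs _ _ h _ => (hFT s hs w (by simp) h.symm).elim
  | @grow T t s _ _ _ _ huniq ih =>
    rw [Finset.coe_insert, Set.union_insert]
    refine (ih fun x hx y hy => hFT x hx y (Finset.mem_insert_of_mem hy)).induce_insert ?_
    have key : ∀ x ∈ F ∪ (T : Set V), G.Adj t x → x = s := fun x hx hadj =>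
      hx.elim (fun hx => (hFT x hx t (by simp) hadj.symm).elim) fun hx => huniq x hx hadj
    intro x hx y hy h1 h2
    rw [key x hx h1, key y hy h2]

/-- An induced tree can be rainbow-connected with one color per vertex other than the root. -/
theorem exists_coloring (h : GrownTree G w T) :
    ∃ c : Sym2 V → V, ∀ x ∈ T, ∀ y ∈ T, RainbowReach G c T (T \ {w}) x y := by
  classical
  induction h with
  | singleton =>
    refine ⟨fun _ => w, fun x hx y hy => ?_⟩
    rw [Finset.mem_singleton] at hx hy
    subst hx hy
    exact .refl (by simp)
  | @grow T t s hT ht hs hadj _ ih =>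
    obtain ⟨c, hc⟩ := ih
    have hwt : t ≠ w := fun h => ht (h ▸ hT.root_mem)
    let c' : Sym2 V → V := fun e => if t ∈ e then t else c e
    have old : ∀ x ∈ T, ∀ y ∈ T, RainbowReach G c' (insert t T : Finset V) (T \ {w}) x y := by
      intro x hx y hy
      refine ((hc x hx y hy).congr (c' := c') fun e he => if_neg fun hte => ht ?_).mono
        (by simp) subset_rfl
      exact he t hte
    have new : ∀ y ∈ T,
        RainbowReach G c' (insert t T : Finset V) ((insert t T : Finset V) \ {w}) t y := by
      intro y hy
      have h1 : RainbowReach G c' (insert t T : Finset V) {t} t s :=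
        .of_adj hadj (by simp) (by simp [hs]) (by simp [c'])
      refine (h1.trans (old s hs y hy) ?_).mono subset_rfl ?_
      · simp [ht]
      · rintro k (rfl | hk)
        · simpa using hwt
        · exact ⟨by simp [hk.1], hk.2⟩
    have hsub : (T : Set V) \ {w} ⊆ (insert t T : Finset V) \ {w} :=
      Set.sdiff_subset_sdiff_left (by simp)
    refine ⟨c', fun x hx y hy => ?_⟩
    rcases Finset.mem_insert.1 hx with rfl | hxT <;> rcases Finset.mem_insert.1 hy with rfl | hyT
    · exact .refl (by simp)
    · exact new y hyT
    · exact (new x hxT).symm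
    · exact (old x hxT y hyT).mono subset_rfl hsub

/-- Among the induced trees inside `R` containing `w`, one of maximum size `T` comes with a set
`C` containing its neighborhood in `R` which can be rainbow-connected with the colors of
`T \ {w}` and one further color `α`, the color `α` not being needed for reaching `w`. -/
theorem exists_cluster [Fintype V] (G : SimpleGraph V) {R : Finset V} {w α : V} (hw : w ∈ R)
    (hα : α ∈ R → α = w) :
    ∃ (T C : Finset V) (c : Sym2 V → V), GrownTree G w T ∧ T ⊆ C ∧ C ⊆ R ∧
      (∀ x ∈ T, ∀ y ∈ R, G.Adj y x → y ∈ C) ∧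
      (∀ e, c e ∈ insert α (T : Set V)) ∧
      (∀ x ∈ C, RainbowReach G c C (T \ {w}) x w) ∧
      ∀ x ∈ C, ∀ y ∈ C, RainbowReach G c C (insert α (T \ {w} : Set V)) x y := by
  classical
  obtain ⟨T, hTmem, hmax⟩ := Finset.exists_max_image
    (Finset.univ.filter fun T => GrownTree G w T ∧ T ⊆ R) Finset.card
    ⟨{w}, by simpa using ⟨GrownTree.singleton, hw⟩⟩
  simp only [Finset.mem_filter, Finset.mem_univ, true_and] at hTmem hmax
  obtain ⟨hT, hTR⟩ := hTmem
  have hαT : α ∉ (T : Set V) \ {w} := fun h => h.2 (hα (hTR h.1))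
  cases hT with
  | singleton =>
    refine ⟨{w}, {w}, fun _ => w, .singleton, subset_rfl, hTR, ?_, by simp, ?_, ?_⟩
    · intro x hx y hy hadj
      rw [Finset.mem_singleton] at hx
      subst hx
      by_contra hyx
      have h := hmax (insert y {x}) ⟨GrownTree.singleton.grow hyx
        (Finset.mem_singleton_self x) hadj (by simp), by simp [Finset.insert_subset_iff, hy, hw]⟩
      rw [Finset.card_insert_of_notMem hyx] at h
      omega
    · intro x hx
      rw [Finset.mem_singleton] at hx
      subst hx
      exact .refl (by simp)
    · intro x hx y hy
      rw [Finset.mem_singleton] at hx hy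
      subst hx hy
      exact .refl (by simp)
  | @grow T t s hT ht hs hts htuniq =>
    obtain ⟨c₀, hc₀⟩ := hT.exists_coloring
    have hTR' : T ⊆ R := (Finset.subset_insert _ _).trans hTR
    have htR : t ∈ R := hTR (by simp)
    have hwt : t ≠ w := fun h => ht (h ▸ hT.root_mem)
    let C : Finset V := R.filter fun v => v ∈ T ∨ ∃ s ∈ T, G.Adj v s
    have hTC : T ⊆ C := fun x hx => by simp [C, hTR' hx, hx]
    have hy : ∀ v : V, ∃ y, v ∈ C → v ∉ T → y ∈ T ∧ G.Adj v y := by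
      intro v
      by_cases hv : ∃ s ∈ T, G.Adj v s
      · exact ⟨hv.choose, fun _ _ => hv.choose_spec⟩
      · exact ⟨v, fun h h' => absurd ((Finset.mem_filter.1 h).2.resolve_left h') hv⟩
    choose y hy using hy
    have clique : ∀ v ∈ C, v ∉ T → (∀ s ∈ T, G.Adj v s → s = y v) → ∀ v' ∈ C, v' ∉ T →
        (∀ s ∈ T, G.Adj v' s → s = y v') → v ≠ v' → G.Adj v v' := by
      intro v hv hvT hvu v' hv' hvT' hvu' hne
      by_contra hnadj
      have h1 : GrownTree G w (insert v T) :=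
        hT.grow hvT (hy v hv hvT).1 (hy v hv hvT).2 hvu
      have hv'T : v' ∉ insert v T := by simp [hne.symm, hvT']
      have h2 : GrownTree G w (insert v' (insert v T)) := by
        refine h1.grow hv'T (Finset.mem_insert_of_mem (hy v' hv' hvT').1) (hy v' hv' hvT').2 ?_
        intro s' hs' hadj
        rcases Finset.mem_insert.1 hs' with rfl | hs'
        · exact (hnadj hadj.symm).elim
        · exact hvu' s' hs' hadj
      have h3 := hmax _ ⟨h2, by
        simp [Finset.insert_subset_iff, hTR', (Finset.mem_filter.1 hv).1,
          (Finset.mem_filter.1 hv').1]⟩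
      rw [Finset.card_insert_of_notMem hv'T, Finset.card_insert_of_notMem hvT,
        Finset.card_insert_of_notMem ht] at h3
      omega
    let c : Sym2 V → V := fun e =>
      if ∀ x ∈ e, x ∈ T then (if c₀ e ∈ T then c₀ e else α)
      else if ∃ v, v ∉ T ∧ e = s(v, y v) then t else α
    have inT : ∀ a ∈ T, ∀ b ∈ T, RainbowReach G c C (T \ {w}) a b := by
      intro a ha b hb
      obtain ⟨p, h1, h2, h3⟩ := hc₀ a ha b hb
      have hcc : ∀ e ∈ p.edges, c e = c₀ e := fun e he => by
        have h4 : ∀ x ∈ e, x ∈ T := fun x hx => h1 x (p.mem_support_of_mem_edges he hx)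
        have h5 : c₀ e ∈ T := (h2 e he).1
        simp only [c, if_pos h4, if_pos h5]
      refine ⟨p, fun z hz => hTC (h1 z hz), fun e he => hcc e he ▸ h2 e he, ?_⟩
      rwa [List.map_congr_left hcc]
    have up : ∀ v ∈ C, v ∉ T → ∀ b ∈ T,
        RainbowReach G c C ((insert t T : Finset V) \ {w}) v b := by
      intro v hv hvT b hb
      obtain ⟨hyT, hadj⟩ := hy v hv hvT
      have h1 : RainbowReach G c C {t} v (y v) := by
        refine .of_adj hadj hv (hTC hyT) ?_
        have h4 : ¬ ∀ x ∈ s(v, y v), x ∈ T := fun h => hvT (h v (by simp))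
        have h5 : ∃ u, u ∉ T ∧ s(v, y v) = s(u, y u) := ⟨v, hvT, rfl⟩
        simp only [c, if_neg h4, if_pos h5, Set.mem_singleton_iff]
      refine (h1.trans (inT _ hyT b hb) (by simp [ht])).mono subset_rfl ?_
      rintro k (rfl | hk)
      · simpa using hwt
      · exact ⟨by simp [hk.1], hk.2⟩
    have not_up : ∀ a ∈ C, a ∉ T → ∀ b ∈ C, b ≠ y a → c s(a, b) = α := by
      intro a ha haT b hb hba
      have h4 : ¬ ∀ x ∈ s(a, b), x ∈ T := fun h => haT (h a (by simp))
      have h5 : ¬ ∃ u, u ∉ T ∧ s(a, b) = s(u, y u) := by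
        rintro ⟨u, hu, hab⟩
        rcases Sym2.eq_iff.1 hab with ⟨rfl, rfl⟩ | ⟨rfl, rfl⟩
        · exact hba rfl
        · exact haT (hy b hb hu).1
      simp only [c, if_neg h4, if_neg h5]
    have down : ∀ a ∈ C, a ∉ T → ∀ b ∈ C, b ≠ y a → G.Adj a b →
        RainbowReach G c C {α} a b := fun a ha haT b hb hba hadj =>
      .of_adj hadj ha hb (not_up a ha haT b hb hba)
    have across : ∀ u ∈ C, u ∉ T → ∀ v ∈ C, v ∉ T → ∀ z ∈ T, G.Adj v z → z ≠ y v →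
        RainbowReach G c C (insert α ((insert t T : Finset V) \ {w} : Set V)) u v := by
      intro u hu huT v hv hvT z hz hadj hne
      refine ((up u hu huT z hz).trans (down v hv hvT z (hTC hz) hne hadj).symm ?_).mono
        subset_rfl (by simp)
      rwa [Set.disjoint_singleton_right]
    have hsub : ((T : Set V) \ {w}) ⊆ (insert t T : Finset V) \ {w} :=
      Set.sdiff_subset_sdiff_left (by simp)
    refine ⟨insert t T, C, c, hT.grow ht hs hts htuniq, ?_, Finset.filter_subset _ _, ?_, ?_, ?_, ?_⟩
    · exact Finset.insert_subset (Finset.mem_filter.2 ⟨htR, .inr ⟨s, hs, hts⟩⟩) hTC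
    · intro x hx v hv hadj
      by_contra hvC
      have hvC' : v ∉ T ∧ ∀ s ∈ T, ¬ G.Adj v s := by simpa [C, hv] using hvC
      obtain rfl : x = t := (Finset.mem_insert.1 hx).resolve_right fun h => hvC'.2 x h hadj
      have hvx : v ∉ insert x T := by simp [hvC'.1, hadj.ne]
      have h := hmax (insert v (insert x T)) ⟨(hT.grow ht hs hts htuniq).grow hvx hx hadj
        fun s' hs' h' => (Finset.mem_insert.1 hs').resolve_right fun h => hvC'.2 s' h h',
        Finset.insert_subset hv hTR⟩
      rw [Finset.card_insert_of_notMem hvx] at h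
      omega
    · intro e
      simp only [c]
      split_ifs <;> simp [*]
    · intro x hx
      by_cases hxT : x ∈ T
      · exact (inT x hxT w hT.root_mem).mono subset_rfl hsub
      · exact up x hx hxT w hT.root_mem
    · intro u hu v hv
      by_cases huT : u ∈ T <;> by_cases hvT : v ∈ T
      · exact (inT u huT v hvT).mono subset_rfl (hsub.trans (Set.subset_insert _ _))
      · exact (up v hv hvT u huT).symm.mono subset_rfl (Set.subset_insert _ _)
      · exact (up u hu huT v hvT).mono subset_rfl (Set.subset_insert _ _)
      · by_cases hv2 : ∀ z ∈ T, G.Adj v z → z = y v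
        · by_cases hu2 : ∀ z ∈ T, G.Adj u z → z = y u
          · by_cases huv : u = v
            · subst huv
              exact .refl hu
            · exact (down u hu huT v hv (fun h => hvT (h ▸ (hy u hu huT).1))
                (clique u hu huT hu2 v hv hvT hv2 huv)).mono subset_rfl (by simp)
          · push Not at hu2
            obtain ⟨z, hz, hadj, hne⟩ := hu2
            exact (across v hv hvT u hu huT z hz hadj hne).symm
        · push Not at hv2
          obtain ⟨z, hz, hadj, hne⟩ := hv2
          exact across u hu huT v hv hvT z hz hadj hne

end GrownTree

/-- The vertices of `D` are rainbow-connected inside `D` with colors from an induced forest `F`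
whose neighbors all lie in `D`. -/
def ForestColorable {V : Type*} (G : SimpleGraph V) (D : Finset V) : Prop :=
  ∃ (F : Finset V) (c : Sym2 V → V), F ⊆ D ∧ F.Nonempty ∧ (G.induce (F : Set V)).IsAcyclic ∧
    (∀ x ∈ F, ∀ y, G.Adj y x → y ∈ D) ∧ (∀ e, c e ∈ F) ∧
    ∀ x ∈ D, ∀ y ∈ D, RainbowReach G c D F x y

theorem exists_forestColorable {V : Type*} [Fintype V] (G : SimpleGraph V) (w : V) :
    ∃ D : Finset V, D.Nonempty ∧ ForestColorable G D := by
  classical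
  obtain ⟨T, C, c, hT, hTC, -, hN, hc, -, hr⟩ :=
    GrownTree.exists_cluster G (Finset.mem_univ w) (α := w) fun _ => rfl
  have hins : insert w (T : Set V) = T := Set.insert_eq_of_mem hT.root_mem
  refine ⟨C, ⟨w, hTC hT.root_mem⟩, T, c, hTC, ⟨w, hT.root_mem⟩, ?_,
    fun x hx y hadj => hN x hx y (Finset.mem_univ y) hadj, fun e => ?_, fun x hx y hy => ?_⟩
  · rw [← Set.empty_union (T : Set V)]
    exact hT.isAcyclic_union (fun v => v.2.elim) (by simp)
  · simpa [hins] using hc e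
  · refine (hr x hx y hy).mono subset_rfl ?_
    rw [Set.insert_sdiff_singleton, hins]

theorem ForestColorable.exists_ssuperset {V : Type*} [Fintype V] {G : SimpleGraph V}
    (hG : G.Connected) {D : Finset V} (hD : D.Nonempty) (h : ForestColorable G D) {u : V}
    (hu : u ∉ D) : ∃ D' : Finset V, D ⊂ D' ∧ ForestColorable G D' := by
  classical
  obtain ⟨F, c, hFD, ⟨α, hα⟩, hF, hFN, hc, hr⟩ := h
  obtain ⟨a, ha⟩ := hD
  obtain ⟨⟨⟨v, w⟩, hvw⟩, -, hv, hw⟩ :=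
    (hG.preconnected a u).some.exists_boundary_dart (D : Set V) ha hu
  simp only [Finset.mem_coe] at hv hw hvw
  obtain ⟨T, C, c', hT, hTC, hCD, hTN, hc', hroot, hr'⟩ :=
    GrownTree.exists_cluster G (R := Dᶜ) (w := w) (α := α) (by simpa using hw)
      fun h => absurd (hFD hα) (Finset.mem_compl.1 h)
  have hdisj : ∀ x ∈ C, x ∉ D := fun x hx => Finset.mem_compl.1 (hCD hx)
  have hwC : w ∈ C := hTC hT.root_mem
  let c₁ : Sym2 V → V := fun e =>
    if ∀ x ∈ e, x ∈ D then c e else if ∀ x ∈ e, x ∈ C then c' e else w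
  have eqD : ∀ e : Sym2 V, (∀ x ∈ e, x ∈ (D : Set V)) → c₁ e = c e := fun e he => if_pos he
  have eqC : ∀ e : Sym2 V, (∀ x ∈ e, x ∈ (C : Set V)) → c₁ e = c' e := by
    intro e he
    have h1 : ¬ ∀ x ∈ e, x ∈ D := by
      induction e with
      | _ x y => exact fun h => hdisj x (he x (by simp)) (h x (by simp))
    exact (if_neg h1).trans (if_pos he)
  have hlink : c₁ s(w, v) = w := by
    have h1 : ¬ ∀ x ∈ s(w, v), x ∈ D := fun h => hw (h w (by simp))
    have h2 : ¬ ∀ x ∈ s(w, v), x ∈ C := fun h => hdisj v (h v (by simp)) hv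
    simp only [c₁, if_neg h1, if_neg h2]
  have hDD : (D : Set V) ⊆ (D ∪ C : Finset V) := by simp
  have hCC : (C : Set V) ⊆ (D ∪ C : Finset V) := by simp
  have cross : ∀ x ∈ C, ∀ y ∈ D,
      RainbowReach G c₁ (D ∪ C : Finset V) (F ∪ T : Finset V) x y := by
    intro x hx y hy
    have h1 : RainbowReach G c₁ (D ∪ C : Finset V) (T \ {w}) x w :=
      ((hroot x hx).congr eqC).mono hCC subset_rfl
    have h2 : RainbowReach G c₁ (D ∪ C : Finset V) {w} w v :=
      .of_adj hvw.symm (hCC hwC) (hDD hv) hlink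
    have h3 : RainbowReach G c₁ (D ∪ C : Finset V) F v y :=
      ((hr v hv y hy).congr eqD).mono hDD subset_rfl
    have h12 : RainbowReach G c₁ (D ∪ C : Finset V) T x v :=
      (h1.trans h2 (by simp)).mono subset_rfl (by simp [hT.root_mem])
    refine (h12.trans h3 ?_).mono subset_rfl (by simp [Set.union_comm])
    exact Set.disjoint_left.2 fun k hkT hkF => hdisj k (hTC hkT) (hFD hkF)
  refine ⟨D ∪ C, ?_, F ∪ T, c₁, Finset.union_subset_union hFD hTC, ⟨α, by simp [hα]⟩, ?_, ?_, ?_, ?_⟩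
  · exact Finset.ssubset_iff_subset_ne.2 ⟨Finset.subset_union_left, fun h => hw (h ▸ by simp [hwC])⟩
  · rw [Finset.coe_union]
    exact hT.isAcyclic_union hF fun x hx y hy hadj => hdisj y (hTC hy) (hFN x hx y hadj.symm)
  · intro x hx y hadj
    rw [Finset.mem_union] at hx ⊢
    by_cases hy : y ∈ D
    · exact .inl hy
    · rcases hx with hx | hx
      · exact .inl (hFN x hx y hadj)
      · exact .inr (hTN x hx y (by simpa using hy) hadj)
  · intro e
    have h1 := hc e
    have h2 : c' e ∈ F ∪ T := by
      rcases hc' e with h | h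
      · simp [h, hα]
      · exact Finset.mem_union_right _ h
    simp only [c₁]
    split_ifs
    · exact Finset.mem_union_left _ h1
    · exact h2
    · exact Finset.mem_union_right _ hT.root_mem
  · intro x hx y hy
    rcases Finset.mem_union.1 hx with hx | hx <;> rcases Finset.mem_union.1 hy with hy | hy
    · exact ((hr x hx y hy).congr eqD).mono hDD (by simp)
    · exact (cross y hy x hx).symm
    · exact cross x hx y hy
    · refine ((hr' x hx y hy).congr eqC).mono hCC (Set.insert_subset (by simp [hα]) ?_)
      exact Set.sdiff_subset.trans (by simp)

theorem forestColorable_univ {V : Type*} [Fintype V] {G : SimpleGraph V} (hG : G.Connected) :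
    ForestColorable G Finset.univ := by
  classical
  obtain ⟨w⟩ := hG.nonempty
  obtain ⟨D₀, hD₀⟩ := exists_forestColorable G w
  obtain ⟨D, hD, hmax⟩ := Finset.exists_max_image
    (Finset.univ.filter fun D : Finset V => D.Nonempty ∧ ForestColorable G D) Finset.card
    ⟨D₀, by simpa using hD₀⟩
  simp only [Finset.mem_filter, Finset.mem_univ, true_and] at hD hmax
  suffices h : ∀ u, u ∈ D from Finset.eq_univ_iff_forall.2 h ▸ hD.2
  by_contra! ⟨u, hu⟩
  obtain ⟨D', hlt, hD'⟩ := hD.2.exists_ssuperset hG hD.1 hu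
  exact absurd (hmax D' ⟨hD.1.mono hlt.subset, hD'⟩) (Finset.card_lt_card hlt).not_ge

/-- For every finite connected simple graph `G`, there is an edge coloring with at most
`forestNum G + 2` colors under which every pair of vertices is joined by a rainbow path,
i.e. `rc(G) ≤ f(G) + 2`. -/
theorem rc_le_forestNum_add_two {V : Type*} [Fintype V] (G : SimpleGraph V)
    (hG : G.Connected) :
    ∃ c : Sym2 V → Fin (forestNum G + 2), IsRainbowConnected G c := by
  classical
  obtain ⟨F, c, -, -, hF, -, hc, hr⟩ := forestColorable_univ hG
  have hcard : F.card ≤ forestNum G + 2 :=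
    (Nat.le_findGreatest (Finset.card_le_univ F) ⟨F, rfl, hF⟩).trans (Nat.le_add_right _ _)
  let g : Sym2 V → Fin (forestNum G + 2) := fun e => Fin.castLE hcard (F.equivFin ⟨c e, hc e⟩)
  have hg : ∀ e e', g e = g e' → c e = c e' := fun e e' h => by
    simpa [g] using h
  refine ⟨g, fun u v => ?_⟩
  obtain ⟨p, hp, hnodup⟩ := (hr u (Finset.mem_univ u) v (Finset.mem_univ v)).exists_isPath
  refine ⟨p, hp, List.Nodup.map_on (fun e he e' he' h => ?_) hp.isTrail.edges_nodup⟩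
  exact List.inj_on_of_nodup_map hnodup he he' (hg e e' h)
end

section
/- For every finite connected simple graph G, the rainbow connection number of G is at most 3·f(G) − 1, where f(G) is the forest number of G. -/
open SimpleGraph

namespace SimpleGraph

open Walk

variable {V : Type*} {G : SimpleGraph V}

/-- Any two vertices of `D` are joined by a walk inside `D` whose edges have pairwise distinct
colors, all of them smaller than `m`. -/
def RainbowOn (G : SimpleGraph V) (D : Finset V) (m : ℕ) (c : Sym2 V → ℕ) : Prop :=
  ∀ u ∈ D, ∀ v ∈ D, ∃ p : G.Walk u v, (∀ x ∈ p.support, x ∈ D) ∧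
    (∀ k ∈ p.edges.map c, k < m) ∧ (p.edges.map c).Nodup

lemma rainbowOn_singleton (s : V) (c : Sym2 V → ℕ) : RainbowOn G {s} 0 c := by
  intro u hu v hv
  rw [Finset.mem_singleton] at hu hv
  subst hu hv
  exact ⟨nil, by simp, by simp, by simp⟩

lemma Walk.map_edges_congr {α : Type*} {D : Finset V} {c c' : Sym2 V → α} {u v : V}
    (p : G.Walk u v) (hp : ∀ x ∈ p.support, x ∈ D)
    (hc : ∀ x ∈ D, ∀ y ∈ D, c' s(x, y) = c s(x, y)) : p.edges.map c' = p.edges.map c := by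
  refine List.map_congr_left fun e he ↦ ?_
  induction e with
  | h x y =>
    exact hc x (hp x (p.fst_mem_support_of_mem_edges he)) y
      (hp y (p.snd_mem_support_of_mem_edges he))

/-- A vertex adjacent to `D` can be added to `D` at the cost of one new color. -/
lemma RainbowOn.exists_insert [DecidableEq V] {D : Finset V} {m : ℕ} {c : Sym2 V → ℕ}
    (h : RainbowOn G D m c) {d x : V} (hd : d ∈ D) (hx : x ∉ D) (hdx : G.Adj d x) :
    ∃ c', RainbowOn G (insert x D) (m + 1) c' := by
  refine ⟨Function.update c s(x, d) m, ?_⟩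
  have hc : ∀ y ∈ D, ∀ z ∈ D, Function.update c s(x, d) m s(y, z) = c s(y, z) := by
    intro y hy z hz
    refine Function.update_of_ne ?_ _ _
    rw [Ne, Sym2.eq_iff]
    rintro (⟨rfl, -⟩ | ⟨-, rfl⟩) <;> contradiction
  have key : ∀ v ∈ D, ∃ p : G.Walk x v, (∀ y ∈ p.support, y ∈ insert x D) ∧
      (∀ k ∈ p.edges.map (Function.update c s(x, d) m), k < m + 1) ∧
      (p.edges.map (Function.update c s(x, d) m)).Nodup := by
    intro v hv
    obtain ⟨p, hp, hm, hn⟩ := h d hd v hv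
    refine ⟨cons hdx.symm p, ?_, ?_, ?_⟩
    · simp only [support_cons, List.mem_cons, Finset.mem_insert]
      grind
    · rw [edges_cons, List.map_cons, p.map_edges_congr hp hc, Function.update_self]
      grind
    · rw [edges_cons, List.map_cons, p.map_edges_congr hp hc, Function.update_self]
      grind
  intro u hu v hv
  rw [Finset.mem_insert] at hu hv
  rcases hu with rfl | hu <;> rcases hv with rfl | hv
  · exact ⟨nil, by simp, by simp, by simp⟩
  · exact key v hv
  · obtain ⟨p, hp, hm, hn⟩ := key u hu
    refine ⟨p.reverse, ?_, ?_, ?_⟩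
    · simpa using hp
    · simpa using hm
    · simpa using hn
  · obtain ⟨p, hp, hm, hn⟩ := h u hu v hv
    refine ⟨p, fun y hy ↦ Finset.mem_insert_of_mem (hp y hy), ?_, ?_⟩
    · rw [p.map_edges_congr hp hc]
      grind
    · rwa [p.map_edges_congr hp hc]

/-- If `S` is dominating, then a rainbow-connected set `D` missing a vertex of `S` can be enlarged
to contain one more vertex of `S` by adding at most three vertices. -/
lemma RainbowOn.exists_superset [DecidableEq V] (hG : G.Connected) {S D : Finset V}
    (hS : ∀ v ∉ S, ∃ s ∈ S, G.Adj v s) {m : ℕ} {c : Sym2 V → ℕ} (h : RainbowOn G D m c)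
    (hD : D.Nonempty) {t : V} (htS : t ∈ S) (htD : t ∉ D) :
    ∃ D' c' m', D ⊆ D' ∧ (∃ s ∈ S, s ∈ D' ∧ s ∉ D) ∧ m' ≤ m + 3 ∧ RainbowOn G D' m' c' := by
  obtain ⟨d₀, hd₀⟩ := hD
  by_cases ht : ∃ d ∈ D, G.Adj d t
  · obtain ⟨d, hd, hdt⟩ := ht
    obtain ⟨c', hc'⟩ := h.exists_insert hd htD hdt
    exact ⟨_, c', m + 1, Finset.subset_insert _ _, ⟨t, htS, by simp, htD⟩, by omega, hc'⟩
  obtain ⟨⟨⟨x, y⟩, hxy⟩, -, hx, hy⟩ := (hG d₀ t).some.exists_boundary_dart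
    {v | v ∈ D ∨ ∃ d ∈ D, G.Adj d v} (Or.inl hd₀) (by simp_all)
  simp only [Set.mem_ofPred_eq, not_or, not_exists, not_and] at hx hy hxy
  obtain ⟨hyD, hy⟩ := hy
  have hxD : x ∉ D := fun hx ↦ hy x hx hxy
  obtain ⟨d, hd, hdx⟩ := hx.resolve_left hxD
  obtain ⟨c₁, h₁⟩ := h.exists_insert hd hxD hdx
  obtain ⟨c₂, h₂⟩ := h₁.exists_insert (Finset.mem_insert_self x D)
    (by simp [hyD, hxy.ne'] : y ∉ insert x D) hxy
  by_cases hyS : y ∈ S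
  · exact ⟨_, c₂, _, by grind, ⟨y, hyS, by simp, hyD⟩, by omega, h₂⟩
  obtain ⟨s, hs, hys⟩ := hS y hyS
  have hsD : s ∉ D := fun hsD ↦ hy s hsD hys.symm
  by_cases hsx : s = x
  · exact ⟨_, c₂, _, by grind, ⟨s, hs, by simp [hsx], hsD⟩, by omega, h₂⟩
  obtain ⟨c₃, h₃⟩ := h₂.exists_insert (Finset.mem_insert_self y _)
    (by simp [hsD, hsx, hys.ne'] : s ∉ insert y (insert x D)) hys
  exact ⟨_, c₃, _, by grind, ⟨s, hs, by simp, hsD⟩, by omega, h₃⟩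

/-- A nonempty dominating set `S` is contained in a set that is rainbow-connected with at most
`3 * (#S - 1)` colors. -/
lemma exists_rainbowOn_superset (hG : G.Connected) {S : Finset V} (hne : S.Nonempty)
    (hS : ∀ v ∉ S, ∃ s ∈ S, G.Adj v s) :
    ∃ D c m, S ⊆ D ∧ m + 3 ≤ 3 * S.card ∧ RainbowOn G D m c := by
  classical
  obtain ⟨s, hs⟩ := hne
  have key : ∀ n (D : Finset V) (c : Sym2 V → ℕ) (m : ℕ), (S \ D).card = n → D.Nonempty →
      m + 3 + 3 * (S \ D).card ≤ 3 * S.card → RainbowOn G D m c →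
      ∃ D c m, S ⊆ D ∧ m + 3 ≤ 3 * S.card ∧ RainbowOn G D m c := by
    intro n
    induction n using Nat.strong_induction_on with
    | _ n ih =>
      intro D c m hn hD hm h
      by_cases hSD : S ⊆ D
      · exact ⟨D, c, m, hSD, by omega, h⟩
      obtain ⟨t, htS, htD⟩ := Finset.not_subset.1 hSD
      obtain ⟨D', c', m', hDD', ⟨s', hs'S, hs'D', hs'D⟩, hm', h'⟩ :=
        h.exists_superset hG hS hD htS htD
      have hlt : (S \ D').card < (S \ D).card :=
        Finset.card_lt_card <| Finset.ssubset_iff_of_subset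
          (Finset.sdiff_subset_sdiff le_rfl hDD') |>.2 ⟨s', by simp [*], by simp [*]⟩
      exact ih _ (hn ▸ hlt) D' c' m' rfl (hD.mono hDD') (by omega) h'
  refine key _ {s} (fun _ ↦ 0) 0 rfl (by simp) ?_ (rainbowOn_singleton s _)
  rw [Finset.card_sdiff_of_subset (by simpa using hs), Finset.card_singleton]
  have := Finset.card_pos.2 ⟨s, hs⟩
  omega

/-- If every vertex outside `D` has two neighbors in `D`, then two additional colors suffice to
rainbow-connect the whole graph. -/
lemma RainbowOn.exists_univ [Fintype V] {D : Finset V} {m : ℕ} {c : Sym2 V → ℕ}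
    (h : RainbowOn G D m c)
    (hD : ∀ v ∉ D, ∃ a ∈ D, ∃ b ∈ D, a ≠ b ∧ G.Adj v a ∧ G.Adj v b) :
    ∃ c', RainbowOn G Finset.univ (m + 2) c' := by
  classical
  choose! a haD b hbD hab ha hb using hD
  let c' : Sym2 V → ℕ := fun e ↦
    if ∃ v ∉ D, e = s(v, a v) then m else if ∃ v ∉ D, e = s(v, b v) then m + 1 else c e
  have hca : ∀ v ∉ D, c' s(v, a v) = m := fun v hv ↦ if_pos ⟨v, hv, rfl⟩
  have hcb : ∀ v ∉ D, c' s(b v, v) = m + 1 := by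
    intro v hv
    have h₁ : ¬ ∃ w ∉ D, s(b v, v) = s(w, a w) := by
      rintro ⟨w, hw, hvw⟩
      rcases Sym2.eq_iff.1 hvw with ⟨h₁, h₂⟩ | ⟨h₁, h₂⟩
      · exact hw (h₁ ▸ hbD v hv)
      · subst h₂
        exact hab v hv h₁.symm
    rw [show c' s(b v, v) = _ from if_neg h₁]
    exact if_pos ⟨v, hv, Sym2.eq_swap⟩
  have hc : ∀ x ∈ D, ∀ y ∈ D, c' s(x, y) = c s(x, y) := by
    intro x hx y hy
    have h₁ : ∀ f : V → V, ¬ ∃ w ∉ D, s(x, y) = s(w, f w) := by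
      rintro f ⟨w, hw, hvw⟩
      rcases Sym2.eq_iff.1 hvw with ⟨rfl, -⟩ | ⟨-, rfl⟩ <;> contradiction
    simp only [c', if_neg (h₁ _)]
  refine ⟨c', fun u _ v _ ↦ ?_⟩
  simp only [Finset.mem_univ, implies_true, true_and]
  by_cases huv : u = v
  · subst huv
    exact ⟨nil, by simp, by simp⟩
  by_cases hu : u ∈ D <;> by_cases hv : v ∈ D
  · obtain ⟨p, hp, hm, hn⟩ := h u hu v hv
    refine ⟨p, ?_⟩
    rw [p.map_edges_congr hp hc]
    exact ⟨fun k hk ↦ (hm k hk).trans (by omega), hn⟩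
  · obtain ⟨p, hp, hm, hn⟩ := h u hu (b v) (hbD v hv)
    refine ⟨p.append (cons (hb v hv).symm nil), ?_⟩
    rw [edges_append, edges_cons, edges_nil, List.map_append, List.map_cons, List.map_nil,
      p.map_edges_congr hp hc, hcb v hv]
    clear * - hm hn
    grind
  · obtain ⟨p, hp, hm, hn⟩ := h (a u) (haD u hu) v hv
    refine ⟨cons (ha u hu) p, ?_⟩
    rw [edges_cons, List.map_cons, p.map_edges_congr hp hc, hca u hu]
    clear * - hm hn
    grind
  · obtain ⟨p, hp, hm, hn⟩ := h (a u) (haD u hu) (b v) (hbD v hv)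
    refine ⟨cons (ha u hu) (p.append (cons (hb v hv).symm nil)), ?_⟩
    rw [edges_cons, edges_append, edges_cons, edges_nil, List.map_cons, List.map_append,
      List.map_cons, List.map_nil, p.map_edges_congr hp hc, hcb v hv, hca u hu]
    clear * - hm hn
    grind

lemma RainbowOn.exists_isRainbowConnected [Fintype V] {n : ℕ} (hn : 0 < n) {c : Sym2 V → ℕ}
    (h : RainbowOn G Finset.univ n c) : ∃ c' : Sym2 V → Fin n, IsRainbowConnected G c' := by
  classical
  refine ⟨fun e ↦ ⟨c e % n, Nat.mod_lt _ hn⟩, fun u v ↦ ?_⟩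
  obtain ⟨p, -, hm, hp⟩ := h u (Finset.mem_univ u) v (Finset.mem_univ v)
  refine ⟨p.bypass, p.bypass_isPath, ?_⟩
  refine List.Nodup.sublist (p.edges_bypass_sublist_edges.map _) ?_
  refine List.Nodup.of_map Fin.val ?_
  rw [List.map_map]
  convert hp using 1
  exact List.map_congr_left fun e he ↦ Nat.mod_eq_of_lt (hm _ (List.mem_map_of_mem he))

/-- Adding a vertex with at most one neighbor in an induced forest yields an induced forest. -/
lemma IsAcyclic.induce_insert_s5 {S : Set V} (hS : (G.induce S).IsAcyclic) {v : V}
    (hv : ∀ a ∈ S, ∀ b ∈ S, G.Adj v a → G.Adj v b → a = b) :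
    (G.induce (insert v S)).IsAcyclic := by
  classical
  intro u p hp
  by_cases hvp : ⟨v, Set.mem_insert v S⟩ ∈ p.support
  · have hq := hp.rotate hvp
    set q := p.rotate _ hvp
    have h₁ : G.Adj v q.snd := q.adj_snd hq.not_nil
    have h₂ : G.Adj v q.penultimate := (q.adj_penultimate hq.not_nil).symm
    exact hq.snd_ne_penultimate <| Subtype.ext <|
      hv _ (q.snd.2.resolve_left h₁.ne') _ (q.penultimate.2.resolve_left h₂.ne') h₁ h₂
  · have hcyc : (p.map (Embedding.induce (insert v S)).toHom).IsCycle :=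
      hp.map Subtype.val_injective
    have hsup : ∀ x ∈ (p.map (Embedding.induce (insert v S)).toHom).support, x ∈ S := by
      intro x hx
      rw [Walk.support_map, List.mem_map] at hx
      obtain ⟨y, hy, rfl⟩ := hx
      refine y.2.resolve_left fun hyv ↦ hvp ?_
      rwa [← show y = ⟨v, Set.mem_insert v S⟩ from Subtype.ext hyv]
    refine hS (Walk.induce S _ hsup) ?_
    rw [← isCycle_map_iff_of_injective (f := (Embedding.induce S).toHom) Subtype.val_injective,
      map_induce]
    exact hcyc

lemma exists_card_eq_forestNum [Fintype V] (G : SimpleGraph V) :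
    ∃ S : Finset V, S.card = forestNum G ∧ (G.induce (S : Set V)).IsAcyclic := by
  classical
  refine Nat.findGreatest_spec (P := fun n ↦ ∃ S : Finset V, S.card = n ∧
    (G.induce (S : Set V)).IsAcyclic) (Nat.zero_le _) ⟨∅, rfl, ?_⟩
  intro v
  simpa using v.2

lemma IsAcyclic.card_le_forestNum [Fintype V] {S : Finset V}
    (hS : (G.induce (S : Set V)).IsAcyclic) : S.card ≤ forestNum G := by
  classical
  exact Nat.le_findGreatest S.card_le_univ ⟨S, rfl, hS⟩

/-- Every vertex outside a maximum induced forest has two neighbors in it. -/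
lemma IsAcyclic.exists_two_adj_of_card_eq_forestNum [Fintype V] {S : Finset V}
    (hS : (G.induce (S : Set V)).IsAcyclic) (hcard : S.card = forestNum G) {v : V} (hv : v ∉ S) :
    ∃ a ∈ S, ∃ b ∈ S, a ≠ b ∧ G.Adj v a ∧ G.Adj v b := by
  classical
  by_contra! hcon
  have hins : (G.induce ((insert v S : Finset V) : Set V)).IsAcyclic := by
    rw [Finset.coe_insert]
    refine hS.induce_insert_s5 fun a ha b hb hva hvb ↦ ?_
    by_contra hab
    exact hcon a ha b hb hab hva hvb
  have := hins.card_le_forestNum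
  rw [Finset.card_insert_of_notMem hv] at this
  omega

end SimpleGraph

/-- For every finite connected simple graph `G`, there is an edge coloring with at most
`3 * forestNum G - 1` colors under which every pair of vertices is joined by a rainbow path,
i.e. `rc(G) ≤ 3f(G) - 1`. -/
theorem rc_le_three_mul_forestNum_sub_one {V : Type*} [Fintype V] (G : SimpleGraph V)
    (hG : G.Connected) :
    ∃ c : Sym2 V → Fin (3 * forestNum G - 1), IsRainbowConnected G c := by
  obtain ⟨S, hcard, hS⟩ := exists_card_eq_forestNum G
  have htwo : ∀ v ∉ S, ∃ a ∈ S, ∃ b ∈ S, a ≠ b ∧ G.Adj v a ∧ G.Adj v b := fun v hv ↦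
    hS.exists_two_adj_of_card_eq_forestNum hcard hv
  have hne : S.Nonempty := by
    obtain ⟨v⟩ := hG.nonempty
    by_cases hv : v ∈ S
    · exact ⟨v, hv⟩
    · obtain ⟨a, ha, -⟩ := htwo v hv
      exact ⟨a, ha⟩
  obtain ⟨D, c, m, hSD, hm, hD⟩ := exists_rainbowOn_superset hG hne fun v hv ↦
    let ⟨a, ha, _, _, _, hva, _⟩ := htwo v hv
    ⟨a, ha, hva⟩
  obtain ⟨c', hc'⟩ := hD.exists_univ fun v hv ↦
    let ⟨a, ha, b, hb, h⟩ := htwo v fun hvS ↦ hv (hSD hvS)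
    ⟨a, hSD ha, b, hSD hb, h⟩
  rw [hcard] at hm
  refine RainbowOn.exists_isRainbowConnected (c := c') (by omega) fun u hu v hv ↦ ?_
  obtain ⟨p, hp, hlt, hnd⟩ := hc' u hu v hv
  exact ⟨p, hp, fun k hk ↦ (hlt k hk).trans_le (by omega), hnd⟩
end
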